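/- arXiv:2507.11888 — 3 statements merged into one kernel-verified Lean document; each statement's English description precedes it below -/
import Mathlib

section
/- The Waldschmidt constant of the D4 configuration equals 2; that is, the infimum over all integers m ≥ 1 of α(I(D4)^{(m)})/m, where α(I(D4)^{(m)}) is the least degree of a nonzero homogeneous polynomial in ℂ[x,y,z,w] vanishing to order at least m at every point of the D4 configuration, equals 2. -/
open MvPolynomial

/-- A polynomial `F` vanishes to order at least `m` at a point with representative
vector `v` if all partial derivatives of `F` of total order less than `m` vanish at `v`. -/
def vanishesToOrder (F : MvPolynomial (Fin 4) ℂ) (v : Fin 4 → ℂ) (m : ℕ) : Prop :=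
  ∀ l : List (Fin 4), l.length < m →
    eval v (l.foldl (fun G i => pderiv i G) F) = 0

/-- The least degree of a nonzero homogeneous polynomial vanishing to order at least `m`
at every point of the configuration `Z`. -/
noncomputable def alphaSymbolic (Z : Set (Fin 4 → ℂ)) (m : ℕ) : ℕ :=
  sInf { d | ∃ F : MvPolynomial (Fin 4) ℂ, F ≠ 0 ∧ F.IsHomogeneous d ∧
    ∀ v ∈ Z, vanishesToOrder F v m }

/-- The D4 configuration: the 12 points of `ℙ³` whose coordinates are the permutations
of `(1 : ±1 : 0 : 0)`, given by representative vectors with exactly two nonzero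
coordinates, the first equal to `1` and the second to `±1`. -/
def D4Config : Set (Fin 4 → ℂ) :=
  { v | ∃ i j : Fin 4, i < j ∧ v i = 1 ∧ (v j = 1 ∨ v j = -1) ∧
    ∀ k, k ≠ i → k ≠ j → v k = 0 }

noncomputable section

/-- Generic Taylor expansion of a polynomial at `v`: substitute `v + t U`. -/
def Phi {n : ℕ} (v : Fin n → ℂ) :
    MvPolynomial (Fin n) ℂ →ₐ[ℂ] Polynomial (MvPolynomial (Fin n) ℂ) :=
  aeval (fun i => Polynomial.C (C (v i)) + Polynomial.X * Polynomial.C (X i))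

/-- Order of vanishing, through the Taylor expansion. -/
def VOrd {n : ℕ} (F : MvPolynomial (Fin n) ℂ) (v : Fin n → ℂ) (m : ℕ) : Prop :=
  (Polynomial.X : Polynomial (MvPolynomial (Fin n) ℂ)) ^ m ∣ Phi v F

/-- Linear forms. -/
def Lin {n : ℕ} (l : MvPolynomial (Fin n) ℂ) : Prop :=
  ∀ v, Phi v l = Polynomial.C (C (eval v l)) + Polynomial.X * Polynomial.C l

lemma Phi_C {n : ℕ} (v : Fin n → ℂ) (c : ℂ) : Phi v (C c) = Polynomial.C (C c) := by
  simp only [Phi, algHom_C]; rfl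

lemma Phi_X {n : ℕ} (v : Fin n → ℂ) (i : Fin n) :
    Phi v (X i) = Polynomial.C (C (v i)) + Polynomial.X * Polynomial.C (X i) := by
  simp [Phi]

lemma Lin_X {n : ℕ} (i : Fin n) : Lin (X i : MvPolynomial (Fin n) ℂ) := by
  intro v; simp [Phi_X]

lemma Lin_zero {n : ℕ} : Lin (0 : MvPolynomial (Fin n) ℂ) := by
  intro v; simp

lemma Lin_add {n : ℕ} {a b : MvPolynomial (Fin n) ℂ} (ha : Lin a) (hb : Lin b) :
    Lin (a + b) := by
  intro v; rw [map_add, ha, hb]; simp only [map_add]; ring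

lemma Lin_smul {n : ℕ} {a : MvPolynomial (Fin n) ℂ} (c : ℂ) (ha : Lin a) :
    Lin (C c * a) := by
  intro v; rw [map_mul, ha, Phi_C]; simp only [map_mul, eval_C]; ring

lemma Phi_coeff_zero {n : ℕ} (v : Fin n → ℂ) (F : MvPolynomial (Fin n) ℂ) :
    (Phi v F).coeff 0 = C (eval v F) := by
  induction F using MvPolynomial.induction_on with
  | C a => simp
  | add p q hp hq => simp [hp, hq]
  | mul_X p i hp => simp [Polynomial.mul_coeff_zero, hp, Phi_X]

lemma Phi_derivative {n : ℕ} (v : Fin n → ℂ) (F : MvPolynomial (Fin n) ℂ) :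
    Polynomial.derivative (Phi v F) = ∑ i, Polynomial.C (X i) * Phi v (pderiv i F) := by
  induction F using MvPolynomial.induction_on with
  | C a => simp
  | add p q hp hq => simp [hp, hq, mul_add, Finset.sum_add_distrib]
  | mul_X p i hp =>
    have h1 : ∀ j, Polynomial.C (X j) * Phi v (pderiv j (p * X i)) =
        (if j = i then Polynomial.C (X i) * Phi v p else 0) +
        (Polynomial.C (X j) * Phi v (pderiv j p)) * Phi v (X i) := by
      intro j
      rw [Derivation.leibniz, smul_eq_mul, smul_eq_mul, map_add, map_mul, map_mul]
      by_cases h : j = i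
      · subst h
        rw [pderiv_X_self, map_one, if_pos rfl]; ring
      · rw [pderiv_X_of_ne (Ne.symm h), map_zero, if_neg h]; ring
    simp only [h1, Finset.sum_add_distrib, Finset.sum_ite_eq', Finset.mem_univ, if_true]
    rw [map_mul, Polynomial.derivative_mul, hp, Finset.sum_mul, Phi_X]
    simp
    ring

lemma ord_of_vanishes (m : ℕ) : ∀ (F : MvPolynomial (Fin 4) ℂ) (v : Fin 4 → ℂ),
    (∀ l : List (Fin 4), l.length < m →
    eval v (l.foldl (fun G i => pderiv i G) F) = 0) → VOrd F v m := by
  induction m with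
  | zero => intro F v _; simp [VOrd]
  | succ m ih =>
    intro F v h
    have h0 : eval v F = 0 := h [] (by simp)
    have h1 : ∀ i, VOrd (pderiv i F) v m := fun i => ih _ _ fun l hl => h (i :: l) (by simpa using hl)
    have h2 : (Polynomial.X : Polynomial (MvPolynomial (Fin 4) ℂ)) ^ m ∣
        Polynomial.derivative (Phi v F) := by
      rw [Phi_derivative]
      exact Finset.dvd_sum fun i _ => (h1 i).mul_left _
    rw [VOrd, Polynomial.X_pow_dvd_iff]
    rw [Polynomial.X_pow_dvd_iff] at h2
    intro k hk
    rcases k with _ | k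
    · rw [Phi_coeff_zero, h0, C_0]
    · have := h2 k (by omega)
      rw [Polynomial.coeff_derivative] at this
      rcases mul_eq_zero.1 this with h | h
      · exact h
      · exfalso
        exact Nat.cast_add_one_ne_zero k h

lemma ord_pull {n k : ℕ} (L : Fin n → MvPolynomial (Fin k) ℂ) (hL : ∀ i, Lin (L i))
    (F : MvPolynomial (Fin n) ℂ) (w : Fin k → ℂ) (m : ℕ)
    (h : VOrd F (fun i => eval w (L i)) m) : VOrd (aeval L F) w m := by
  have key : (Phi w).comp (aeval L) =
      (Polynomial.mapAlgHom (aeval L)).comp (Phi (fun i => eval w (L i))) := by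
    apply MvPolynomial.algHom_ext
    intro i
    simp [Phi_X, hL i w]
  have := congrArg (fun f => f F) key
  simp only [AlgHom.comp_apply] at this
  rw [VOrd, this]
  obtain ⟨G, hG⟩ := h
  rw [hG, map_mul, map_pow]
  simp

lemma ord_div {n : ℕ} {l G : MvPolynomial (Fin n) ℂ} (hl : Lin l) (hl0 : l ≠ 0)
    (v : Fin n → ℂ) (m : ℕ) (h : VOrd (l * G) v m) :
    (eval v l ≠ 0 → VOrd G v m) ∧ VOrd G v (m - 1) := by
  have h1 : eval v l ≠ 0 → VOrd G v m := by
    intro hv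
    unfold VOrd at h ⊢
    rw [map_mul] at h
    refine Polynomial.prime_X.pow_dvd_of_dvd_mul_left m ?_ h
    rw [hl, Polynomial.X_dvd_iff]
    simpa using hv
  refine ⟨h1, ?_⟩
  by_cases hv : eval v l = 0
  · rcases m with _ | m
    · simp [VOrd]
    unfold VOrd at h ⊢
    rw [map_mul, hl, hv, C_0, Polynomial.C_0, zero_add, pow_succ', mul_assoc] at h
    have h2 := (mul_dvd_mul_iff_left Polynomial.X_ne_zero).1 h
    rw [Polynomial.X_pow_dvd_iff] at h2 ⊢
    intro d hd
    have := h2 d (by omega)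
    rw [Polynomial.coeff_C_mul] at this
    exact (mul_eq_zero.1 this).resolve_left hl0
  · exact (pow_dvd_pow _ (Nat.sub_le m 1)).trans (h1 hv)

lemma dvd_of_subst {n : ℕ} (l : MvPolynomial (Fin n) ℂ) (g : Fin n → MvPolynomial (Fin n) ℂ)
    (hg : ∀ i, l ∣ X i - g i) (F : MvPolynomial (Fin n) ℂ) (h : aeval g F = 0) : l ∣ F := by
  have key : (Ideal.Quotient.mkₐ ℂ (Ideal.span {l})).comp (aeval g) =
      Ideal.Quotient.mkₐ ℂ (Ideal.span {l}) := by
    apply MvPolynomial.algHom_ext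
    intro i
    simp only [AlgHom.comp_apply, aeval_X, Ideal.Quotient.mkₐ_eq_mk]
    symm
    rw [Ideal.Quotient.eq, Ideal.mem_span_singleton]
    exact hg i
  have := congrArg (fun f => f F) key
  simp only [AlgHom.comp_apply, h, map_zero] at this
  symm at this
  rw [Ideal.Quotient.mkₐ_eq_mk, Ideal.Quotient.eq_zero_iff_mem, Ideal.mem_span_singleton] at this
  exact this

lemma dvd_of_restrict {n k : ℕ} (l : MvPolynomial (Fin n) ℂ) (L : Fin n → MvPolynomial (Fin k) ℂ)
    (s : Fin k → MvPolynomial (Fin n) ℂ) (hs : ∀ i, l ∣ X i - aeval s (L i))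
    (F : MvPolynomial (Fin n) ℂ) (h : aeval L F = 0) : l ∣ F := by
  apply dvd_of_subst l (fun i => aeval s (L i)) hs
  have : (aeval (fun i => aeval s (L i)) : MvPolynomial (Fin n) ℂ →ₐ[ℂ] _) =
      (aeval s).comp (aeval L) := by
    apply MvPolynomial.algHom_ext
    intro i; simp
  rw [this, AlgHom.comp_apply, h, map_zero]

lemma homog_div {n : ℕ} {l G : MvPolynomial (Fin n) ℂ} {d : ℕ} (hl : l.IsHomogeneous 1)
    (hF : (l * G).IsHomogeneous d) (h0 : l * G ≠ 0) : ∃ e, d = e + 1 ∧ G.IsHomogeneous e := by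
  have hl0 : l ≠ 0 := left_ne_zero_of_mul h0
  have key : l * G = ∑ i ∈ Finset.range (G.totalDegree + 1),
      if d = i + 1 then l * homogeneousComponent i G else 0 := by
    have h1 : homogeneousComponent d (l * G) = l * G := homogeneousComponent_eq_self hF
    conv_lhs => rw [← h1]
    conv_lhs => rw [← sum_homogeneousComponent G]
    rw [Finset.mul_sum, map_sum]
    refine Finset.sum_congr rfl fun i _ => ?_
    have := hl.mul (homogeneousComponent_isHomogeneous i G)
    rw [homogeneousComponent_of_mem ((mem_homogeneousSubmodule _ _).2 this)]
    rw [add_comm 1 i]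
  rcases d with _ | e
  · exfalso
    apply h0
    rw [key]
    apply Finset.sum_eq_zero
    intro i _
    rw [if_neg (by omega)]
  · refine ⟨e, rfl, ?_⟩
    simp only [add_left_inj, Finset.sum_ite_eq] at key
    split_ifs at key with h
    · rw [mul_left_cancel₀ hl0 key]
      exact homogeneousComponent_isHomogeneous _ _
    · exact absurd key h0

open Classical in
lemma step {n : ℕ} {F l : MvPolynomial (Fin n) ℂ} {d : ℕ} (hF0 : F ≠ 0) (hF : F.IsHomogeneous d)
    (hl : Lin l) (hl1 : l.IsHomogeneous 1) (h : l ∣ F) :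
    ∃ G e, F = l * G ∧ d = e + 1 ∧ G ≠ 0 ∧ G.IsHomogeneous e ∧
      ∀ v m, VOrd F v m → VOrd G v (m - if eval v l = 0 then 1 else 0) := by
  obtain ⟨G, rfl⟩ := h
  obtain ⟨e, rfl, he⟩ := homog_div hl1 hF hF0
  refine ⟨G, e, rfl, rfl, right_ne_zero_of_mul hF0, he, fun v m hv => ?_⟩
  have := ord_div hl (left_ne_zero_of_mul hF0) v m hv
  split_ifs with h
  · exact this.2
  · exact this.1 h

lemma ord_mono {n : ℕ} {F : MvPolynomial (Fin n) ℂ} {v : Fin n → ℂ} {m k : ℕ} (h : VOrd F v m)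
    (hk : k ≤ m) : VOrd F v k := (pow_dvd_pow _ hk).trans h

lemma eval_of_ord {n : ℕ} {F : MvPolynomial (Fin n) ℂ} {v : Fin n → ℂ} {m : ℕ} (h : VOrd F v m)
    (hk : 1 ≤ m) : eval v F = 0 := by
  have := ord_mono h hk
  rw [VOrd, pow_one, Polynomial.X_dvd_iff, Phi_coeff_zero] at this
  simpa using this

lemma homog_subst {n : ℕ} {F : MvPolynomial (Fin n) ℂ} {d : ℕ} (hF : F.IsHomogeneous d)
    (c : Fin n → ℂ) (r : MvPolynomial (Fin n) ℂ) :
    aeval (fun i => C (c i) * r) F = r ^ d * C (eval c F) := by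
  rw [aeval_def, eval₂_eq', eval_eq', map_sum, Finset.mul_sum]
  refine Finset.sum_congr rfl fun s hs => ?_
  have hd : ∑ i, s i = d := by
    have := hF.degree_eq_sum_deg_support hs
    rw [this]
    symm
    apply Finset.sum_subset (Finset.subset_univ _)
    intro i _ hi
    simpa using hi
  simp only [mul_pow, Finset.prod_mul_distrib, Finset.prod_pow_eq_pow_sum, hd, map_mul, map_prod,
    map_pow, algebraMap_eq]
  ring

lemma dvd_of_point {n : ℕ} {F : MvPolynomial (Fin n) ℂ} {d : ℕ} (hF : F.IsHomogeneous d)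
    (c : Fin n → ℂ) (r l : MvPolynomial (Fin n) ℂ) (hc : eval c F = 0)
    (h : ∀ i, l ∣ X i - C (c i) * r) : l ∣ F := by
  apply dvd_of_subst l _ h
  rw [homog_subst hF, hc, C_0, mul_zero]

lemma binary (c : ℂ) (hc : c ≠ 0) (d : ℕ) : ∀ (F : MvPolynomial (Fin 2) ℂ) (m1 m2 m3 : ℕ), F ≠ 0 →
    F.IsHomogeneous d → VOrd F ![1, 0] m1 → VOrd F ![0, 1] m2 → VOrd F ![1, c] m3 →
    m1 + m2 + m3 ≤ d := by
  induction d with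
  | zero =>
    intro F m1 m2 m3 h0 hF h1 h2 h3
    have hh : ∀ v m, VOrd F v m → m = 0 := by
      intro v m h
      by_contra hm
      have := eval_of_ord h (by omega)
      rw [← totalDegree_zero_iff_isHomogeneous, totalDegree_eq_zero_iff_eq_C] at hF
      rw [hF, eval_C] at this
      rw [this, C_0] at hF
      exact h0 hF
    have := hh _ _ h1
    have := hh _ _ h2
    have := hh _ _ h3
    omega
  | succ d ih =>
    intro F m1 m2 m3 h0 hF h1 h2 h3
    by_cases k1 : 1 ≤ m1
    · obtain ⟨G, e, -, hd, hG0, hG, ho⟩ := step h0 hF (Lin_X 1) (isHomogeneous_X _ _)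
        (dvd_of_point hF _ (X 0) (X 1) (eval_of_ord h1 k1) (by intro i; fin_cases i <;> simp))
      obtain rfl : d = e := by omega
      have := ih G _ _ _ hG0 hG (ho _ _ h1) (ho _ _ h2) (ho _ _ h3)
      simp [hc] at this
      omega
    by_cases k2 : 1 ≤ m2
    · obtain ⟨G, e, -, hd, hG0, hG, ho⟩ := step h0 hF (Lin_X 0) (isHomogeneous_X _ _)
        (dvd_of_point hF _ (X 1) (X 0) (eval_of_ord h2 k2) (by intro i; fin_cases i <;> simp))
      obtain rfl : d = e := by omega
      have := ih G _ _ _ hG0 hG (ho _ _ h1) (ho _ _ h2) (ho _ _ h3)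
      simp at this
      omega
    by_cases k3 : 1 ≤ m3
    · obtain ⟨G, e, -, hd, hG0, hG, ho⟩ := step h0 hF (l := X 1 + C (-c) * X 0)
        (Lin_add (Lin_X 1) (Lin_smul _ (Lin_X 0)))
        ((isHomogeneous_X _ _).add (isHomogeneous_C_mul_X _ _))
        (dvd_of_point hF _ (X 0) _ (eval_of_ord h3 k3)
          (by intro i; fin_cases i <;> simp [sub_eq_add_neg]))
      obtain rfl : d = e := by omega
      have := ih G _ _ _ hG0 hG (ho _ _ h1) (ho _ _ h2) (ho _ _ h3)
      simp [hc] at this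
      omega
    omega

/-- The equation of a line of the star configuration. -/
def lineEq (a b : ℂ) : MvPolynomial (Fin 3) ℂ := C (a * b) * X 0 + C (-b) * X 1 + X 2

lemma line_dvd (a b : ℂ) (ha : a ≠ 0) {d : ℕ} (F : MvPolynomial (Fin 3) ℂ) (m1 m2 m3 : ℕ)
    (hF : F.IsHomogeneous d) (h1 : VOrd F ![1, a, 0] m1) (h2 : VOrd F ![0, 1, b] m2)
    (h3 : VOrd F ![1, 0, -(a * b)] m3) (hd : d < m1 + m2 + m3) : lineEq a b ∣ F := by
  let L : Fin 3 → MvPolynomial (Fin 2) ℂ := ![X 0, C a * X 0 + X 1, C b * X 1]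
  have hL : ∀ i, Lin (L i) := by
    intro i
    fin_cases i
    · exact Lin_X 0
    · exact Lin_add (Lin_smul _ (Lin_X 0)) (Lin_X 1)
    · exact Lin_smul _ (Lin_X 1)
  have hL1 : ∀ i, (L i).IsHomogeneous 1 := by
    intro i
    fin_cases i
    · exact isHomogeneous_X _ _
    · exact (isHomogeneous_C_mul_X _ _).add (isHomogeneous_X _ _)
    · exact isHomogeneous_C_mul_X _ _
  have e1 : (fun i => eval ![1, 0] (L i)) = ![1, a, 0] := by
    ext i; fin_cases i <;> simp [L]
  have e2 : (fun i => eval ![0, 1] (L i)) = ![0, 1, b] := by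
    ext i; fin_cases i <;> simp [L]
  have e3 : (fun i => eval ![1, -a] (L i)) = ![1, 0, -(a * b)] := by
    ext i; fin_cases i <;> simp [L, mul_comm]
  apply dvd_of_restrict (lineEq a b) L ![X 0, X 1 + C (-a) * X 0]
  · intro i
    fin_cases i
    · simp [L]
    · simp [L]
    · simp [L, lineEq]
      apply dvd_of_eq
      ring
  · by_contra h0
    rw [← e1] at h1
    rw [← e2] at h2
    rw [← e3] at h3
    have hh : (aeval L F).IsHomogeneous d := by simpa using hF.aeval L hL1
    have := binary (-a) (neg_ne_zero.2 ha) d (aeval L F) m1 m2 m3 h0 hh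
      (ord_pull L hL F _ _ h1) (ord_pull L hL F _ _ h2) (ord_pull L hL F _ _ h3)
    omega

/-- Orders at the six points of the planar star configuration. -/
def Six (F : MvPolynomial (Fin 3) ℂ) (p q r : ℤˣ → ℕ) : Prop :=
  (∀ a : ℤˣ, VOrd F ![1, ((a : ℤ) : ℂ), 0] (p a)) ∧
  (∀ a : ℤˣ, VOrd F ![0, 1, ((a : ℤ) : ℂ)] (q a)) ∧
  (∀ a : ℤˣ, VOrd F ![1, 0, ((a : ℤ) : ℂ)] (r a))

lemma six_step (a b : ℤˣ) {F : MvPolynomial (Fin 3) ℂ} {d : ℕ} {p q r : ℤˣ → ℕ} (hF0 : F ≠ 0)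
    (hF : F.IsHomogeneous d) (h : Six F p q r) (hd : d < p a + q b + r (-(a * b))) :
    ∃ G e, d = e + 1 ∧ G ≠ 0 ∧ G.IsHomogeneous e ∧
      Six G (fun x => p x - if x = a then 1 else 0) (fun x => q x - if x = b then 1 else 0)
        (fun x => r x - if x = -(a * b) then 1 else 0) := by
  obtain ⟨h1, h2, h3⟩ := h
  have hb : ((b : ℤ) : ℂ) ≠ 0 := by exact_mod_cast b.ne_zero
  have ha : ((a : ℤ) : ℂ) ≠ 0 := by exact_mod_cast a.ne_zero
  have hab : (((-(a * b) : ℤˣ) : ℤ) : ℂ) = -(((a : ℤ) : ℂ) * ((b : ℤ) : ℂ)) := by push_cast; rfl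
  have h3' := h3 (-(a * b))
  rw [hab] at h3'
  have hdvd := line_dvd ((a : ℤ) : ℂ) ((b : ℤ) : ℂ) ha F (p a) (q b) (r (-(a * b))) hF
    (h1 a) (h2 b) h3' hd
  obtain ⟨G, e, -, hd, hG0, hG, ho⟩ := step hF0 hF (l := lineEq ((a : ℤ) : ℂ) ((b : ℤ) : ℂ))
    (Lin_add (Lin_add (Lin_smul _ (Lin_X 0)) (Lin_smul _ (Lin_X 1))) (Lin_X 2))
    (((isHomogeneous_C_mul_X _ _).add (isHomogeneous_C_mul_X _ _)).add (isHomogeneous_X _ _)) hdvd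
  refine ⟨G, e, hd, hG0, hG, fun x => ?_, fun x => ?_, fun x => ?_⟩
  · refine ord_mono (ho _ _ (h1 x)) (Nat.sub_le_sub_left ?_ _)
    split_ifs with k1 k2 <;> try simp
    apply k2
    simp [lineEq] at k1
    have : ((b : ℤ) : ℂ) * (((x : ℤ) : ℂ) - (a : ℤ)) = 0 := by linear_combination -k1
    have := sub_eq_zero.1 ((mul_eq_zero.1 this).resolve_left hb)
    exact_mod_cast this
  · refine ord_mono (ho _ _ (h2 x)) (Nat.sub_le_sub_left ?_ _)
    split_ifs with k1 k2 <;> try simp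
    apply k2
    simp [lineEq] at k1
    have : ((x : ℤ) : ℂ) = (b : ℤ) := by linear_combination k1
    exact_mod_cast this
  · refine ord_mono (ho _ _ (h3 x)) (Nat.sub_le_sub_left ?_ _)
    split_ifs with k1 k2 <;> try simp
    apply k2
    simp [lineEq] at k1
    have : ((x : ℤ) : ℂ) = ((-(a * b) : ℤˣ) : ℤ) := by push_cast; linear_combination k1
    exact_mod_cast this

lemma planar (d : ℕ) : ∀ (F : MvPolynomial (Fin 3) ℂ) (m : ℕ), F ≠ 0 →
    F.IsHomogeneous d → Six F (fun _ => m) (fun _ => m) (fun _ => m) → 2 * m ≤ d := by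
  induction d using Nat.strong_induction_on with
  | _ d ih =>
    intro F m h0 hF h
    by_contra hd
    have n1 : (1 : ℤˣ) ≠ -1 := by decide
    have n2 : (-1 : ℤˣ) ≠ 1 := by decide
    obtain ⟨F1, d1, e1, h01, hF1, o1⟩ := six_step 1 1 h0 hF h (by omega)
    obtain ⟨F2, d2, e2, h02, hF2, o2⟩ := six_step 1 (-1) h01 hF1 o1 (by simp [n1, n2]; omega)
    obtain ⟨F3, d3, e3, h03, hF3, o3⟩ := six_step (-1) 1 h02 hF2 o2 (by simp [n1, n2]; omega)
    obtain ⟨F4, d4, e4, h04, hF4, o4⟩ := six_step (-1) (-1) h03 hF3 o3 (by simp [n1, n2]; omega)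
    have := ih d4 (by omega) F4 (m - 2) h04 hF4 (by
      refine ⟨fun x => ord_mono (o4.1 x) ?_, fun x => ord_mono (o4.2.1 x) ?_,
        fun x => ord_mono (o4.2.2 x) ?_⟩ <;>
      rcases Int.units_eq_one_or x with rfl | rfl <;> simp [n1, n2] <;> omega)
    omega

/-- Restriction to a coordinate plane. -/
def restr (k : Fin 4) : Fin 4 → MvPolynomial (Fin 3) ℂ :=
  k.insertNth (α := fun _ => MvPolynomial (Fin 3) ℂ) 0 X

lemma restr_self (k : Fin 4) : restr k k = 0 := by simp [restr]

lemma restr_succAbove (k : Fin 4) (i : Fin 3) : restr k (k.succAbove i) = X i := by simp [restr]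

lemma restr_mem (k : Fin 4) (w : Fin 3 → ℂ) (i j : Fin 3) (hij : i < j) (hi : w i = 1)
    (hj : w j = 1 ∨ w j = -1) (h : ∀ t, t ≠ i → t ≠ j → w t = 0) :
    (fun t => eval w (restr k t)) ∈ D4Config := by
  refine ⟨k.succAbove i, k.succAbove j, Fin.succAbove_lt_succAbove_iff.2 hij, ?_, ?_, ?_⟩
  · simpa [restr_succAbove] using hi
  · simpa [restr_succAbove] using hj
  · intro t
    refine Fin.succAboveCases k ?_ (fun t => ?_) t
    · intro _ _; simp [restr_self]
    · intro h1 h2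
      simp only [restr_succAbove, eval_X]
      exact h t (fun h => h1 (by rw [h])) (fun h => h2 (by rw [h]))

lemma plane_dvd (k : Fin 4) {d m : ℕ} (F : MvPolynomial (Fin 4) ℂ) (hF : F.IsHomogeneous d)
    (h : ∀ v ∈ D4Config, VOrd F v m) (hd : d < 2 * m) : X k ∣ F := by
  have hL : ∀ i, Lin (restr k i) := by
    intro i
    refine Fin.succAboveCases k ?_ (fun t => ?_) i
    · rw [restr_self]; exact Lin_zero
    · rw [restr_succAbove]; exact Lin_X t
  have hL1 : ∀ i, (restr k i).IsHomogeneous 1 := by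
    intro i
    refine Fin.succAboveCases k ?_ (fun t => ?_) i
    · rw [restr_self]; exact isHomogeneous_zero _ _ _
    · rw [restr_succAbove]; exact isHomogeneous_X _ _
  apply dvd_of_restrict (X k) (restr k) (fun i => X (k.succAbove i))
  · intro i
    refine Fin.succAboveCases k ?_ (fun t => ?_) i
    · simp [restr_self]
    · simp [restr_succAbove]
  · by_contra h0
    have hu : ∀ x : ℤˣ, ((x : ℤ) : ℂ) = 1 ∨ ((x : ℤ) : ℂ) = -1 := by
      intro x
      rcases Int.units_eq_one_or x with rfl | rfl <;> simp
    have := planar d (aeval (restr k) F) m h0 (by simpa using hF.aeval _ hL1) (by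
      refine ⟨fun x => ?_, fun x => ?_, fun x => ?_⟩
      · refine ord_pull _ hL F _ _ (h _ (restr_mem k _ 0 1 (by decide) rfl (hu x) ?_))
        intro t; fin_cases t <;> simp
      · refine ord_pull _ hL F _ _ (h _ (restr_mem k _ 1 2 (by decide) rfl (hu x) ?_))
        intro t; fin_cases t <;> simp
      · refine ord_pull _ hL F _ _ (h _ (restr_mem k _ 0 2 (by decide) rfl (hu x) ?_))
        intro t; fin_cases t <;> simp)
    omega

lemma X_dvd_div {i j : Fin 4} (hij : i ≠ j) {G : MvPolynomial (Fin 4) ℂ} (h : X i ∣ X j * G) :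
    X i ∣ G := by
  refine (X_prime.dvd_or_dvd h).resolve_left ?_
  rw [X_dvd_X]
  exact hij

lemma space (d : ℕ) : ∀ (F : MvPolynomial (Fin 4) ℂ) (m : ℕ), F ≠ 0 →
    F.IsHomogeneous d → (∀ v ∈ D4Config, VOrd F v m) → 2 * m ≤ d := by
  induction d using Nat.strong_induction_on with
  | _ d ih =>
    intro F m h0 hF h
    by_contra hd
    have hk := fun k => plane_dvd k F hF h (by omega)
    obtain ⟨F1, d1, rfl, e1, h01, hF1, o1⟩ := step h0 hF (Lin_X 0) (isHomogeneous_X _ _) (hk 0)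
    have hk1 := fun k (hk0 : k ≠ 0) => X_dvd_div hk0 (hk k)
    obtain ⟨F2, d2, rfl, e2, h02, hF2, o2⟩ := step h01 hF1 (Lin_X 1) (isHomogeneous_X _ _)
      (hk1 1 (by decide))
    obtain ⟨F3, d3, rfl, e3, h03, hF3, o3⟩ := step h02 hF2 (Lin_X 2) (isHomogeneous_X _ _)
      (X_dvd_div (by decide) (hk1 2 (by decide)))
    obtain ⟨F4, d4, rfl, e4, h04, hF4, o4⟩ := step h03 hF3 (Lin_X 3) (isHomogeneous_X _ _)
      (X_dvd_div (by decide) (X_dvd_div (by decide) (hk1 3 (by decide))))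
    have := ih d4 (by omega) F4 (m - 2) h04 hF4 (by
      intro v hv
      refine ord_mono (o4 _ _ (o3 _ _ (o2 _ _ (o1 _ _ (h v hv))))) ?_
      obtain ⟨i, j, hij, hi, hj, -⟩ := hv
      have hi' : v i ≠ 0 := by rw [hi]; exact one_ne_zero
      have hj' : v j ≠ 0 := by rcases hj with hj | hj <;> rw [hj] <;> simp
      clear hi hj
      simp only [eval_X]
      fin_cases i <;> fin_cases j <;> first
        | exact absurd hij (by decide)
        | (simp only [Fin.zero_eta, Fin.mk_one, Fin.reduceFinMk] at hi' hj'
           simp only [hi', hj', if_false]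
           split_ifs <;> omega))
    omega

lemma vanishes_of_pow_dvd (P : MvPolynomial (Fin 4) ℂ) (v : Fin 4 → ℂ) (hP : eval v P = 0) (m : ℕ) :
    ∀ G, P ^ m ∣ G → vanishesToOrder G v m := by
  induction m with
  | zero => intro G _ l hl; simp at hl
  | succ m ih =>
    intro G hG l hl
    rcases l with _ | ⟨i, l⟩
    · obtain ⟨H, rfl⟩ := hG
      simp [hP]
    · rw [List.foldl_cons]
      refine ih _ ?_ l (by simpa using hl)
      obtain ⟨H, rfl⟩ := hG
      rw [Derivation.leibniz, Derivation.leibniz_pow]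
      simp only [smul_eq_mul, Nat.add_sub_cancel, nsmul_eq_mul]
      refine dvd_add ⟨P * pderiv i H, by ring⟩ ⟨H * (((m + 1 : ℕ) : MvPolynomial (Fin 4) ℂ) *
        pderiv i P), by ring⟩

/-- The product of the coordinates. -/
def prodX : MvPolynomial (Fin 4) ℂ := X 0 * X 1 * (X 2 * X 3)

lemma prodX_ne : prodX ≠ 0 := by
  simp [prodX, X_ne_zero]

lemma prodX_hom : prodX.IsHomogeneous 4 :=
  ((isHomogeneous_X _ 0).mul (isHomogeneous_X _ 1)).mul
    ((isHomogeneous_X _ 2).mul (isHomogeneous_X _ 3))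

lemma prodX_vanish : ∀ v ∈ D4Config, vanishesToOrder prodX v 2 := by
  rintro v ⟨i, j, hij, -, -, h⟩ l hl
  have key : ∃ s t : Fin 4, s ≠ t ∧ v s = 0 ∧ v t = 0 ∧ X s * X t ∣ prodX := by
    have hz : ∃ s t : Fin 4, s ≠ t ∧ s ≠ i ∧ s ≠ j ∧ t ≠ i ∧ t ≠ j := by
      clear h; revert i j; decide
    obtain ⟨s, t, hst, h1, h2, h3, h4⟩ := hz
    refine ⟨s, t, hst, h s h1 h2, h t h3 h4, ?_⟩
    have e : prodX = ∏ i, X i := by simp [prodX, Fin.prod_univ_four, mul_assoc]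
    rw [e, ← Finset.prod_pair hst]
    exact Finset.prod_dvd_prod_of_subset _ _ _ (Finset.subset_univ _)
  obtain ⟨s, t, -, hs, ht, H, hH⟩ := key
  rw [hH]
  rcases l with _ | ⟨i, l⟩
  · simp [hs]
  · obtain rfl : l = [] := by
      rw [List.length_cons] at hl
      exact List.length_eq_zero_iff.1 (by omega)
    simp [hs, ht, Derivation.leibniz]

lemma nonempty (m : ℕ) : { d | ∃ F : MvPolynomial (Fin 4) ℂ, F ≠ 0 ∧ F.IsHomogeneous d ∧
    ∀ v ∈ D4Config, vanishesToOrder F v m }.Nonempty :=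
  ⟨_, prodX ^ m, pow_ne_zero _ prodX_ne, prodX_hom.pow m, fun v hv =>
    vanishes_of_pow_dvd prodX v (prodX_vanish v hv [] (by simp)) m _ dvd_rfl⟩

lemma alpha_ge (m : ℕ) : 2 * m ≤ alphaSymbolic D4Config m := by
  obtain ⟨F, h0, hF, h⟩ := Nat.sInf_mem (nonempty m)
  exact space _ F m h0 hF fun v hv => ord_of_vanishes m F v (h v hv)

lemma alpha_two : alphaSymbolic D4Config 2 = 4 :=
  le_antisymm (Nat.sInf_le ⟨prodX, prodX_ne, prodX_hom, prodX_vanish⟩) (alpha_ge 2)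

end

/-- The Waldschmidt constant of the D4 configuration equals 2. -/
theorem waldschmidt_D4 :
    sInf { x : ℝ | ∃ m : ℕ, 1 ≤ m ∧ x = (alphaSymbolic D4Config m : ℝ) / m } = 2 := by
  apply IsLeast.csInf_eq
  refine ⟨⟨2, by norm_num, by rw [alpha_two]; norm_num⟩, ?_⟩
  rintro x ⟨m, hm, rfl⟩
  have : (2 * m : ℝ) ≤ alphaSymbolic D4Config m := by exact_mod_cast alpha_ge m
  rw [le_div_iff₀ (by exact_mod_cast hm)]
  exact this
end

section
/- For every integer m ≥ 1 and every nonzero homogeneous polynomial F ∈ ℂ[x,y,z,w] of degree d that vanishes to order at least m at each of the 12 points of the D4 configuration, one has d ≥ 2m. -/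
open MvPolynomial

noncomputable def lineHom (v : Fin 4 → ℂ) :
    MvPolynomial (Fin 4) ℂ →ₐ[ℂ] Polynomial (MvPolynomial (Fin 4) ℂ) :=
  aeval (fun i => Polynomial.C (C (v i)) + Polynomial.X * Polynomial.C (X i))

theorem lineHom_X (v : Fin 4 → ℂ) (i : Fin 4) :
    lineHom v (X i) = Polynomial.C (C (v i)) + Polynomial.X * Polynomial.C (X i) := by
  simp [lineHom]

theorem lineHom_C (v : Fin 4 → ℂ) (a : ℂ) :
    lineHom v (C a) = Polynomial.C (C a) := by
  rw [lineHom, ← algebraMap_eq, AlgHom.commutes]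
  rfl

theorem derivative_lineHom (v : Fin 4 → ℂ) (F : MvPolynomial (Fin 4) ℂ) :
    Polynomial.derivative (lineHom v F) =
      ∑ i, Polynomial.C (X i) * lineHom v (pderiv i F) := by
  induction F using MvPolynomial.induction_on with
  | C a => simp [lineHom_C]
  | add p q hp hq => simp [hp, hq, mul_add, Finset.sum_add_distrib]
  | mul_X p n hp =>
    have h1 : ∀ i, pderiv i (p * X n) = pderiv i p * X n + p * pderiv i (X n) := by
      intro i; rw [Derivation.leibniz]; simp only [smul_eq_mul]; ring
    simp only [map_mul, Polynomial.derivative_mul, hp, h1, map_add, mul_add,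
      Finset.sum_add_distrib]
    congr 1
    · rw [Finset.sum_mul]; refine Finset.sum_congr rfl fun i _ => ?_; ring
    · rw [Finset.sum_eq_single n]
      · rw [pderiv_X_self, lineHom_X]; simp; ring
      · intro b _ hb
        rw [pderiv_X_of_ne (Ne.symm hb)]; simp
      · simp

theorem coeff_zero_lineHom (v : Fin 4 → ℂ) (F : MvPolynomial (Fin 4) ℂ) :
    (lineHom v F).coeff 0 = C (eval v F) := by
  induction F using MvPolynomial.induction_on with
  | C a => simp [lineHom_C]
  | add p q hp hq => simp [hp, hq]
  | mul_X p n hp => simp [hp, lineHom_X, Polynomial.mul_coeff_zero]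

theorem dvd_of_vanishes (v : Fin 4 → ℂ) (m : ℕ) : ∀ F : MvPolynomial (Fin 4) ℂ,
    vanishesToOrder F v m → Polynomial.X ^ m ∣ lineHom v F := by
  induction m with
  | zero => intro F _; simp
  | succ m ih =>
    intro F h
    have h0 : eval v F = 0 := h [] (by simp)
    have hd : Polynomial.X ^ m ∣ Polynomial.derivative (lineHom v F) := by
      rw [derivative_lineHom]
      refine Finset.dvd_sum fun i _ => Dvd.dvd.mul_left (ih _ ?_) _
      intro l hl
      exact h (i :: l) (by simpa using hl)
    rw [Polynomial.X_pow_dvd_iff] at hd ⊢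
    intro k hk
    cases k with
    | zero => rw [coeff_zero_lineHom, h0, map_zero]
    | succ k =>
      have := hd k (by omega)
      rw [Polynomial.coeff_derivative] at this
      rcases mul_eq_zero.mp this with h | h
      · exact h
      · exfalso; exact Nat.cast_add_one_ne_zero k h

theorem aeval_scale (F : MvPolynomial (Fin 4) ℂ) (d : ℕ)
    (hF : F.IsHomogeneous d) (c : Polynomial ℂ) (g : Fin 4 → Polynomial ℂ) :
    aeval (fun i => c * g i) F = c ^ d * aeval g F := by
  rw [aeval_def, aeval_def, eval₂_eq', eval₂_eq', Finset.mul_sum]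
  refine Finset.sum_congr rfl fun e he => ?_
  have h : d = ∑ i, e i := by
    have h1 := hF.degree_eq_sum_deg_support he
    rw [h1]
    exact Finset.sum_subset (Finset.subset_univ _) (by simp)
  rw [h, ← Finset.prod_pow_eq_pow_sum]
  simp only [mul_pow, Finset.prod_mul_distrib]
  ring

/-- Vanishing along a curve through a multiple of the point. -/
theorem curve_dvd (v : Fin 4 → ℂ) (m d : ℕ) (F : MvPolynomial (Fin 4) ℂ)
    (hF : F.IsHomogeneous d) (h : Polynomial.X ^ m ∣ lineHom v F)
    (γ : Fin 4 → Polynomial ℂ) (s c : ℂ) (hc : c ≠ 0)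
    (hγ : ∀ i, (γ i).eval s = c * v i) :
    (Polynomial.X - Polynomial.C s) ^ m ∣ aeval γ F := by
  have h1 : ∀ i, ∃ δ : Polynomial ℂ,
      γ i = Polynomial.C c * (Polynomial.C (v i) + (Polynomial.X - Polynomial.C s) * δ) := by
    intro i
    have : Polynomial.X - Polynomial.C s ∣ γ i - Polynomial.C (c * v i) := by
      rw [Polynomial.dvd_iff_isRoot]; simp [hγ]
    obtain ⟨δ, hδ⟩ := this
    refine ⟨Polynomial.C c⁻¹ * δ, ?_⟩
    have hcc : Polynomial.C c * Polynomial.C c⁻¹ = 1 := by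
      rw [← Polynomial.C_mul, mul_inv_cancel₀ hc, Polynomial.C_1]
    rw [Polynomial.C_mul] at hδ
    linear_combination hδ - (Polynomial.X - Polynomial.C s) * δ * hcc
  choose δ hδ using h1
  let φ : Polynomial (MvPolynomial (Fin 4) ℂ) →+* Polynomial ℂ :=
    Polynomial.eval₂RingHom (aeval δ : MvPolynomial (Fin 4) ℂ →ₐ[ℂ] Polynomial ℂ).toRingHom
      (Polynomial.X - Polynomial.C s)
  have h2 : ∀ F : MvPolynomial (Fin 4) ℂ, φ (lineHom v F) =
      aeval (fun i => Polynomial.C (v i) + (Polynomial.X - Polynomial.C s) * δ i) F := by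
    intro F
    induction F using MvPolynomial.induction_on with
    | C a => simp [lineHom_C, φ]
    | add p q hp hq => simp_all
    | mul_X p n hp =>
      simp_all [lineHom_X, φ]
      exact Or.inl (mul_comm _ _)
  have h3 : aeval γ F = Polynomial.C c ^ d *
      aeval (fun i => Polynomial.C (v i) + (Polynomial.X - Polynomial.C s) * δ i) F := by
    have : γ = fun i => Polynomial.C c *
      (Polynomial.C (v i) + (Polynomial.X - Polynomial.C s) * δ i) := funext hδ
    rw [this]
    exact aeval_scale F d hF _ _
  rw [h3, ← h2 F]
  have := map_dvd φ h
  simp only [map_pow] at this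
  have hx : φ Polynomial.X = Polynomial.X - Polynomial.C s := by simp [φ]
  rw [hx] at this
  exact this.mul_left _

/-- The part of the argument that deals with one linear factor. -/
theorem dvd_factor (v : Fin 4 → ℂ) (i : Fin 4) (m : ℕ)
    (B : Polynomial (MvPolynomial (Fin 4) ℂ))
    (h : Polynomial.X ^ m ∣ lineHom v (X i) * B) :
    Polynomial.X ^ (m - if v i = 0 then 1 else 0) ∣ B := by
  have hp : Prime (Polynomial.X : Polynomial (MvPolynomial (Fin 4) ℂ)) := Polynomial.prime_X
  rw [lineHom_X] at h
  split_ifs with hv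
  · rw [hv, map_zero, map_zero, zero_add, mul_assoc] at h
    cases m with
    | zero => simp
    | succ m =>
      rw [pow_succ', mul_dvd_mul_iff_left hp.ne_zero] at h
      refine hp.pow_dvd_of_dvd_mul_left _ ?_ h
      rw [Polynomial.X_dvd_iff]
      simp
  · refine hp.pow_dvd_of_dvd_mul_left _ ?_ h
    rw [Polynomial.X_dvd_iff]
    simpa using hv

theorem D4_zero_count (v : Fin 4 → ℂ) (hv : v ∈ D4Config) :
    (if v 0 = 0 then 1 else 0) + (if v 1 = 0 then 1 else 0) +
      (if v 2 = 0 then 1 else 0) + (if v 3 = 0 then 1 else 0) ≤ 2 := by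
  obtain ⟨i, j, hij, hi, hj, -⟩ := hv
  have hi' : v i ≠ 0 := by rw [hi]; exact one_ne_zero
  have hj' : v j ≠ 0 := by rcases hj with h | h <;> rw [h] <;> simp
  fin_cases i <;> fin_cases j <;> simp at hij <;> simp at hi' hj' <;>
    simp only [hi', hj', if_false] <;> split_ifs <;> simp

theorem dvd_quotient (v : Fin 4 → ℂ) (hv : v ∈ D4Config) (m : ℕ)
    (G : MvPolynomial (Fin 4) ℂ)
    (h : Polynomial.X ^ m ∣ lineHom v ((∏ i, X i) * G)) :
    Polynomial.X ^ (m - 2) ∣ lineHom v G := by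
  rw [Fin.prod_univ_four] at h
  simp only [map_mul, mul_assoc] at h
  have h4 := dvd_factor v 3 _ _ (dvd_factor v 2 _ _ (dvd_factor v 1 _ _ (dvd_factor v 0 _ _ h)))
  refine (pow_dvd_pow _ ?_).trans h4
  have := D4_zero_count v hv
  omega

theorem homog_quotient (d : ℕ) (G : MvPolynomial (Fin 4) ℂ) (hG : G ≠ 0)
    (h : ((∏ i, X i) * G).IsHomogeneous d) : ∃ e, d = e + 4 ∧ G.IsHomogeneous e := by
  have hm : (∏ i, X i : MvPolynomial (Fin 4) ℂ) =
      monomial (∑ i, Finsupp.single i 1) 1 := by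
    rw [monomial_sum_one]; rfl
  have key : ∀ u, coeff u G ≠ 0 → u.degree + 4 = d := by
    intro u hu
    have : coeff (u + ∑ i, Finsupp.single i 1) ((∏ i, X i) * G) ≠ 0 := by
      rw [hm, add_comm, coeff_monomial_mul, one_mul]; exact hu
    have h2 := h.coeff_eq_zero (d := u + ∑ i, Finsupp.single i 1)
    by_contra hne
    apply this
    apply h2
    rw [map_add, map_sum]
    simpa using hne
  obtain ⟨u, hu⟩ := ne_zero_iff.mp hG
  refine ⟨u.degree, (key u hu).symm, ?_⟩
  intro w hw
  have h1 := key w hw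
  have h2 := key u hu
  have h3 : w.degree = u.degree := by omega
  rw [← h3]
  simp [Finsupp.weight_apply, Finsupp.degree, Finsupp.sum]
  rfl

theorem four_roots (p : Polynomial ℂ) (m : ℕ) (a b c e : ℂ)
    (hab : a ≠ b) (hac : a ≠ c) (hae : a ≠ e) (hbc : b ≠ c) (hbe : b ≠ e) (hce : c ≠ e)
    (ha : (Polynomial.X - Polynomial.C a) ^ m ∣ p)
    (hb : (Polynomial.X - Polynomial.C b) ^ m ∣ p)
    (hc : (Polynomial.X - Polynomial.C c) ^ m ∣ p)
    (he : (Polynomial.X - Polynomial.C e) ^ m ∣ p)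
    (hdeg : p.natDegree < 4 * m) : p = 0 := by
  have cop : ∀ x y : ℂ, x ≠ y → IsCoprime ((Polynomial.X - Polynomial.C x) ^ m)
      ((Polynomial.X - Polynomial.C y) ^ m) := fun x y hxy =>
    (Polynomial.isCoprime_X_sub_C_of_isUnit_sub (sub_ne_zero.mpr hxy).isUnit).pow
  have h1 := (cop a b hab).mul_dvd ha hb
  have h2 := ((cop a c hac).mul_left (cop b c hbc)).mul_dvd h1 hc
  have h3 := (((cop a e hae).mul_left (cop b e hbe)).mul_left (cop c e hce)).mul_dvd h2 he
  refine Polynomial.eq_zero_of_dvd_of_natDegree_lt h3 ?_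
  have mon : ∀ x : ℂ, ((Polynomial.X - Polynomial.C x) ^ m).Monic := fun x =>
    (Polynomial.monic_X_sub_C x).pow m
  rw [(((mon a).mul (mon b)).mul (mon c)).natDegree_mul (mon e),
    ((mon a).mul (mon b)).natDegree_mul (mon c), (mon a).natDegree_mul (mon b)]
  simp only [Polynomial.natDegree_pow, Polynomial.natDegree_X_sub_C]
  omega

/-- Points `e_a + ε e_b` are multiples of points of the configuration. -/
theorem curve_dvd_D4 (m d : ℕ) (F : MvPolynomial (Fin 4) ℂ)
    (hF : F.IsHomogeneous d) (h : ∀ v ∈ D4Config, Polynomial.X ^ m ∣ lineHom v F)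
    (γ : Fin 4 → Polynomial ℂ) (s c ε : ℂ) (hc : c ≠ 0) (hε : ε = 1 ∨ ε = -1)
    (a b : Fin 4) (hab : a ≠ b) (ha : (γ a).eval s = c) (hb : (γ b).eval s = c * ε)
    (h0 : ∀ k, k ≠ a → k ≠ b → (γ k).eval s = 0) :
    (Polynomial.X - Polynomial.C s) ^ m ∣ aeval γ F := by
  have hε2 : ε * ε = 1 := by rcases hε with rfl | rfl <;> norm_num
  have hε0 : ε ≠ 0 := by rintro rfl; simp at hε2
  rcases lt_or_gt_of_ne hab with hlt | hlt
  · refine curve_dvd (fun k => if k = a then 1 else if k = b then ε else 0) m d F hF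
      (h _ ⟨a, b, hlt, by simp, ?_, ?_⟩) γ s c hc ?_
    · simpa [hab.symm] using hε
    · intro k hk1 hk2; simp [hk1, hk2]
    · intro k
      by_cases hk1 : k = a
      · subst hk1; simp [ha]
      · by_cases hk2 : k = b
        · subst hk2; simp [hk1, hb]
        · simp [hk1, hk2, h0]
  · refine curve_dvd (fun k => if k = b then 1 else if k = a then ε else 0) m d F hF
      (h _ ⟨b, a, hlt, by simp, ?_, ?_⟩) γ s (c * ε) (mul_ne_zero hc hε0) ?_
    · simpa [hab] using hε
    · intro k hk1 hk2; simp [hk1, hk2]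
    · intro k
      by_cases hk1 : k = a
      · subst hk1; simp [ha, hab, mul_assoc, hε2]
      · by_cases hk2 : k = b
        · subst hk2; simp [hb]
        · simp [hk1, hk2, h0]

/-- The conic through four of the six points in a coordinate plane and a general point
of that plane lies in the zero set of `F`. -/
theorem plane_generic (m d : ℕ) (hd : d < 2 * m) (F : MvPolynomial (Fin 4) ℂ)
    (hF : F.IsHomogeneous d) (h : ∀ v ∈ D4Config, Polynomial.X ^ m ∣ lineHom v F)
    (j k l : Fin 4) (hjk : j ≠ k) (hjl : j ≠ l) (hkl : k ≠ l)
    (y₁ y₂ y₃ : ℂ) (h1 : y₁ ≠ 0) (h2 : y₂ ≠ 0) (h3 : y₃ ≠ 0)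
    (h1' : y₁ + 1 ≠ 0) (h2' : y₂ + 1 ≠ 0) (h3' : y₃ + 1 ≠ 0)
    (h12 : y₁ - y₂ ≠ 0) (h13 : y₁ - y₃ ≠ 0) (h23 : y₂ - y₃ ≠ 0) :
    eval (fun n => if n = j then y₁ + y₂ - y₃ else if n = k then y₁ - y₂ else
      if n = l then -y₃ else 0) F = 0 := by
  let L : ℂ → Polynomial ℂ := fun y => Polynomial.C y - Polynomial.C (y + 1) * Polynomial.X
  have hL : ∀ y s, (L y).eval s = y - (y + 1) * s := by intro y s; simp [L]
  let ψ₁ := Polynomial.C y₁ * (L y₂ * L y₃)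
  let ψ₂ := Polynomial.C y₂ * (L y₁ * L y₃)
  let ψ₃ := Polynomial.C y₃ * (L y₁ * L y₂)
  have e1 : ∀ s, ψ₁.eval s = y₁ * ((y₂ - (y₂ + 1) * s) * (y₃ - (y₃ + 1) * s)) := by
    intro s; simp [ψ₁, hL]
  have e2 : ∀ s, ψ₂.eval s = y₂ * ((y₁ - (y₁ + 1) * s) * (y₃ - (y₃ + 1) * s)) := by
    intro s; simp [ψ₂, hL]
  have e3 : ∀ s, ψ₃.eval s = y₃ * ((y₁ - (y₁ + 1) * s) * (y₂ - (y₂ + 1) * s)) := by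
    intro s; simp [ψ₃, hL]
  let γ : Fin 4 → Polynomial ℂ := fun n => if n = j then ψ₁ + ψ₂ - ψ₃ else
    if n = k then ψ₁ - ψ₂ else if n = l then -ψ₃ else 0
  have gj : γ j = ψ₁ + ψ₂ - ψ₃ := by simp [γ]
  have gk : γ k = ψ₁ - ψ₂ := by simp [γ, hjk.symm]
  have gl : γ l = -ψ₃ := by simp [γ, hjl.symm, hkl.symm]
  have g0 : ∀ n, n ≠ j → n ≠ k → n ≠ l → γ n = 0 := by
    intro n a b c; simp [γ, a, b, c]
  have hdegL : ∀ y, (L y).natDegree ≤ 1 := by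
    intro y; simp only [L]; compute_degree
  have hdegψ : ∀ y a b : ℂ, (Polynomial.C y * (L a * L b)).natDegree ≤ 2 := by
    intro y a b
    refine (Polynomial.natDegree_C_mul_le _ _).trans (Polynomial.natDegree_mul_le.trans ?_)
    have := hdegL a
    have := hdegL b
    omega
  have hdegγ : ∀ n, (γ n).natDegree ≤ 2 := by
    intro n
    have d1 : ψ₁.natDegree ≤ 2 := hdegψ _ _ _
    have d2 : ψ₂.natDegree ≤ 2 := hdegψ _ _ _
    have d3 : ψ₃.natDegree ≤ 2 := hdegψ _ _ _
    simp only [γ]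
    split_ifs
    · exact Polynomial.natDegree_sub_le_of_le (Polynomial.natDegree_add_le_of_degree_le d1 d2) d3
    · exact Polynomial.natDegree_sub_le_of_le d1 d2
    · rwa [Polynomial.natDegree_neg]
    · simp
  have hdeg := aeval_natDegree_le F hF.totalDegree_le γ hdegγ
  have hs : ∀ y z : ℂ, y + 1 ≠ 0 → z - (z + 1) * (y / (y + 1)) = (z - y) / (y + 1) := by
    intro y z hy; field_simp; ring
  have neg : ∀ y z : ℂ, y - z ≠ 0 → z - y ≠ 0 := by
    intro y z hyz h0; apply hyz; linear_combination -h0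
  have hne : ∀ y z : ℂ, y + 1 ≠ 0 → z + 1 ≠ 0 → y - z ≠ 0 → y / (y + 1) ≠ z / (z + 1) := by
    intro y z hy hz hyz heq
    rw [div_eq_div_iff hy hz] at heq
    apply hyz; linear_combination heq
  have hne0 : ∀ y : ℂ, y ≠ 0 → y + 1 ≠ 0 → (0 : ℂ) ≠ y / (y + 1) := by
    intro y hy hy'; exact (div_ne_zero hy hy').symm
  have hp : aeval γ F = 0 := by
    refine four_roots _ m 0 (y₁ / (y₁ + 1)) (y₂ / (y₂ + 1)) (y₃ / (y₃ + 1))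
      (hne0 _ h1 h1') (hne0 _ h2 h2') (hne0 _ h3 h3')
      (hne _ _ h1' h2' h12) (hne _ _ h1' h3' h13) (hne _ _ h2' h3' h23) ?_ ?_ ?_ ?_ (by omega)
    · refine curve_dvd_D4 m d F hF h γ _ (y₁ * y₂ * y₃) (-1)
        (mul_ne_zero (mul_ne_zero h1 h2) h3) (Or.inr rfl) j l hjl ?_ ?_ ?_
      · rw [gj, Polynomial.eval_sub, Polynomial.eval_add, e1, e2, e3]; ring
      · rw [gl, Polynomial.eval_neg, e3]; ring
      · intro n a b
        by_cases c : n = k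
        · rw [c, gk, Polynomial.eval_sub, e1, e2]; ring
        · rw [g0 n a c b, Polynomial.eval_zero]
    · refine curve_dvd_D4 m d F hF h γ _
        (y₁ * ((y₂ - y₁) / (y₁ + 1) * ((y₃ - y₁) / (y₁ + 1)))) 1 ?_ (Or.inl rfl) j k hjk ?_ ?_ ?_
      · exact mul_ne_zero h1 (mul_ne_zero (div_ne_zero (neg _ _ h12) h1')
          (div_ne_zero (neg _ _ h13) h1'))
      · rw [gj, Polynomial.eval_sub, Polynomial.eval_add, e1, e2, e3]
        simp only [hs _ _ h1']; ring
      · rw [gk, Polynomial.eval_sub, e1, e2]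
        simp only [hs _ _ h1']; ring
      · intro n a b
        by_cases c : n = l
        · rw [c, gl, Polynomial.eval_neg, e3]
          simp only [hs _ _ h1']; ring
        · rw [g0 n a b c, Polynomial.eval_zero]
    · refine curve_dvd_D4 m d F hF h γ _
        (y₂ * ((y₁ - y₂) / (y₂ + 1) * ((y₃ - y₂) / (y₂ + 1)))) (-1) ?_ (Or.inr rfl)
          j k hjk ?_ ?_ ?_
      · exact mul_ne_zero h2 (mul_ne_zero (div_ne_zero h12 h2')
          (div_ne_zero (neg _ _ h23) h2'))
      · rw [gj, Polynomial.eval_sub, Polynomial.eval_add, e1, e2, e3]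
        simp only [hs _ _ h2']; ring
      · rw [gk, Polynomial.eval_sub, e1, e2]
        simp only [hs _ _ h2']; ring
      · intro n a b
        by_cases c : n = l
        · rw [c, gl, Polynomial.eval_neg, e3]
          simp only [hs _ _ h2']; ring
        · rw [g0 n a b c, Polynomial.eval_zero]
    · refine curve_dvd_D4 m d F hF h γ _
        (-(y₃ * ((y₁ - y₃) / (y₃ + 1) * ((y₂ - y₃) / (y₃ + 1))))) 1 ?_ (Or.inl rfl)
          j l hjl ?_ ?_ ?_
      · exact neg_ne_zero.mpr (mul_ne_zero h3 (mul_ne_zero (div_ne_zero h13 h3')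
          (div_ne_zero h23 h3')))
      · rw [gj, Polynomial.eval_sub, Polynomial.eval_add, e1, e2, e3]
        simp only [hs _ _ h3']; ring
      · rw [gl, Polynomial.eval_neg, e3]
        simp only [hs _ _ h3']; ring
      · intro n a b
        by_cases c : n = k
        · rw [c, gk, Polynomial.eval_sub, e1, e2]
          simp only [hs _ _ h3']; ring
        · rw [g0 n a c b, Polynomial.eval_zero]
  have hev : ∀ G : MvPolynomial (Fin 4) ℂ, Polynomial.eval 1 (aeval γ G) =
      eval (fun n => (γ n).eval 1) G := by
    intro G
    induction G using MvPolynomial.induction_on with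
    | C a => simp
    | add p q hp hq => simp [hp, hq]
    | mul_X p n hp => simp [hp]
  have := hev F
  rw [hp, Polynomial.eval_zero] at this
  refine Eq.trans ?_ this.symm
  congr 2
  funext n
  simp only [γ]
  split_ifs
  · rw [Polynomial.eval_sub, Polynomial.eval_add, e1, e2, e3]; ring
  · rw [Polynomial.eval_sub, e1, e2]; ring
  · rw [Polynomial.eval_neg, e3]; ring
  · simp

theorem eval_bind (z : Fin 4 → ℂ) (f : Fin 4 → MvPolynomial (Fin 4) ℂ)
    (F : MvPolynomial (Fin 4) ℂ) : eval z (bind₁ f F) = eval (fun n => eval z (f n)) F := by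
  induction F using MvPolynomial.induction_on with
  | C a => simp
  | add p q hp hq => simp [hp, hq]
  | mul_X p n hp => simp [hp]

theorem X_dvd_sub (i : Fin 4) (F : MvPolynomial (Fin 4) ℂ) :
    X i ∣ F - bind₁ (fun n => if n = i then 0 else X n) F := by
  induction F using MvPolynomial.induction_on with
  | C a => simp
  | add p q hp hq =>
    rw [map_add, add_sub_add_comm]; exact dvd_add hp hq
  | mul_X p n hp =>
    rw [map_mul, bind₁_X_right]
    split_ifs with hn
    · rw [hn]; simp
    · rw [← sub_mul]; exact hp.mul_right _

theorem X_dvd_of_lt (m d : ℕ) (hd : d < 2 * m) (F : MvPolynomial (Fin 4) ℂ)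
    (hF : F.IsHomogeneous d) (h : ∀ v ∈ D4Config, Polynomial.X ^ m ∣ lineHom v F)
    (i : Fin 4) : X i ∣ F := by
  have hex : ∀ i : Fin 4, ∃ j k l : Fin 4, j ≠ k ∧ j ≠ l ∧ k ≠ l ∧ j ≠ i ∧ k ≠ i ∧ l ≠ i ∧
      ∀ n, n = i ∨ n = j ∨ n = k ∨ n = l := by decide
  obtain ⟨j, k, l, hjk, hjl, hkl, hji, hki, hli, hall⟩ := hex i
  have hsub := X_dvd_sub i F
  suffices hQ : bind₁ (fun n => if n = i then 0 else X n) F = 0 by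
    rwa [hQ, sub_zero] at hsub
  let Y₁ : MvPolynomial (Fin 4) ℂ := C (1 / 2) * (X j - X l + X k)
  let Y₂ : MvPolynomial (Fin 4) ℂ := C (1 / 2) * (X j - X l - X k)
  let Y₃ : MvPolynomial (Fin 4) ℂ := -X l
  let B := Y₁ * Y₂ * Y₃ * (Y₁ + 1) * (Y₂ + 1) * (Y₃ + 1) * (Y₁ - Y₂) * (Y₁ - Y₃) * (Y₂ - Y₃)
  have hB : B ≠ 0 := by
    intro hB
    have := congrArg (eval (fun n => if n = l then (-3 : ℂ) else if n = k then -1 else 0)) hB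
    simp [B, Y₁, Y₂, Y₃, hjk, hjl, hkl] at this
    norm_num at this
  have hprod : bind₁ (fun n => if n = i then 0 else X n) F * B = 0 := by
    apply MvPolynomial.funext
    intro z
    rw [map_mul, map_zero]
    by_cases hz : eval z B = 0
    · rw [hz, mul_zero]
    · simp only [B, map_mul, mul_eq_zero, not_or, map_add, map_sub, map_one] at hz
      obtain ⟨⟨⟨⟨⟨⟨⟨⟨h1, h2⟩, h3⟩, h1'⟩, h2'⟩, h3'⟩, h12⟩, h13⟩, h23⟩ := hz
      have hg := plane_generic m d hd F hF h j k l hjk hjl hkl _ _ _ h1 h2 h3 h1' h2' h3' h12 h13 h23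
      have : eval z (bind₁ (fun n => if n = i then 0 else X n) F) = 0 := by
        rw [eval_bind]
        refine Eq.trans ?_ hg
        congr 2
        funext n
        rcases hall n with rfl | rfl | rfl | rfl
        · simp [hji.symm, hki.symm, hli.symm]
        · simp [hji, Y₁, Y₂, Y₃]; ring
        · simp [hki, hjk.symm, Y₁, Y₂]; ring
        · simp [hli, hjl.symm, hkl.symm, Y₃]
      rw [this, zero_mul]
  exact (mul_eq_zero.mp hprod).resolve_right hB

theorem main_aux (m : ℕ) : ∀ (d : ℕ) (F : MvPolynomial (Fin 4) ℂ), F ≠ 0 →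
    F.IsHomogeneous d → (∀ v ∈ D4Config, Polynomial.X ^ m ∣ lineHom v F) → 2 * m ≤ d := by
  induction m using Nat.strong_induction_on with
  | _ m ih =>
    intro d F hF hhom h
    by_contra hlt
    rw [not_le] at hlt
    have hdvd := X_dvd_of_lt m d hlt F hhom h
    have hprod : (∏ i, X i) ∣ F := by
      refine Finset.prod_dvd_of_isRelPrime ?_ (fun i _ => hdvd i)
      intro a _ b _ hab
      have hpa : Prime (X a : MvPolynomial (Fin 4) ℂ) := MvPolynomial.X_prime
      refine (hpa.irreducible.isRelPrime_iff_not_dvd).mpr ?_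
      rw [X_dvd_X]
      exact hab
    obtain ⟨G, rfl⟩ := hprod
    have hG : G ≠ 0 := right_ne_zero_of_mul hF
    obtain ⟨e, rfl, he⟩ := homog_quotient d G hG hhom
    have := ih (m - 2) (by omega) e G hG he (fun v hv => dvd_quotient v hv m G (h v hv))
    omega

/-- Any nonzero homogeneous polynomial of degree `d` vanishing to order at least `m ≥ 1`
at all 12 points of the D4 configuration satisfies `d ≥ 2m`. -/
theorem degree_lower_bound_D4 (m : ℕ) (hm : 1 ≤ m) (d : ℕ)
    (F : MvPolynomial (Fin 4) ℂ) (hF : F ≠ 0) (hhom : F.IsHomogeneous d)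
    (hvan : ∀ v ∈ D4Config, vanishesToOrder F v m) :
    2 * m ≤ d := by
  exact main_aux m d F hF hhom (fun v hv => dvd_of_vanishes v m F (hvan v hv))
end

section
/- The Waldschmidt constant of the B4 configuration equals 2; that is, the infimum over all integers m ≥ 1 of α(I(B4)^{(m)})/m, where α(I(B4)^{(m)}) is the least degree of a nonzero homogeneous polynomial in ℂ[x,y,z,w] vanishing to order at least m at every point of the B4 configuration, equals 2. -/
open MvPolynomial

/-- The B4 configuration: the 16 points of `ℙ³` consisting of the 12 points of the
D4 configuration together with the four coordinate points. -/
def B4Config : Set (Fin 4 → ℂ) :=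
  D4Config ∪ { v | ∃ i : Fin 4, v = Pi.single i 1 }

namespace B4Proof

/-- Expansion of a polynomial along the line through `v` with direction `u`. -/
noncomputable abbrev lineExp {σ R : Type*} [CommRing R] [Algebra ℂ R] (v : σ → ℂ) (u : σ → R) :
    MvPolynomial σ ℂ →ₐ[ℂ] Polynomial R :=
  aeval (fun i => Polynomial.C (algebraMap ℂ R (v i)) + Polynomial.X * Polynomial.C (u i))

lemma derivative_lineExp {R : Type*} [CommRing R] [Algebra ℂ R] (v : Fin 4 → ℂ) (u : Fin 4 → R)
    (F : MvPolynomial (Fin 4) ℂ) :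
    Polynomial.derivative (lineExp v u F) =
      ∑ i, Polynomial.C (u i) * lineExp v u (pderiv i F) := by
  induction F using MvPolynomial.induction_on with
  | C a =>
    simp [Polynomial.algebraMap_apply]
  | add p q hp hq =>
    simp only [map_add, hp, hq, mul_add, Finset.sum_add_distrib]
  | mul_X p j hp =>
    have e : Polynomial.derivative (lineExp v u (X j)) = Polynomial.C (u j) := by
      rw [lineExp, aeval_X]; simp
    have e2 : ∑ i, Polynomial.C (u i) * (lineExp v u p * lineExp v u (pderiv i (X j))) =
        Polynomial.C (u j) * lineExp v u p := by
      rw [Finset.sum_eq_single j]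
      · rw [pderiv_X_self, map_one, mul_one]
      · intro b _ hb
        rw [pderiv_X_of_ne hb.symm, map_zero, mul_zero, mul_zero]
      · intro h; exact absurd (Finset.mem_univ j) h
    simp only [Derivation.leibniz, smul_eq_mul]
    simp only [map_add (lineExp v u), map_mul (lineExp v u)]
    simp only [mul_add (Polynomial.C _), Finset.sum_add_distrib]
    rw [e2, Polynomial.derivative_mul, e, hp, Finset.sum_mul, add_comm,
      mul_comm _ (Polynomial.C (u j))]
    refine congrArg₂ (· + ·) rfl (Finset.sum_congr rfl fun i _ => ?_)
    rw [mul_assoc, mul_comm (lineExp v u (pderiv i p))]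

lemma lineExp_coeff_zero {R : Type*} [CommRing R] [Algebra ℂ R] (v : Fin 4 → ℂ) (u : Fin 4 → R)
    (F : MvPolynomial (Fin 4) ℂ) :
    (lineExp v u F).coeff 0 = algebraMap ℂ R (eval v F) := by
  induction F using MvPolynomial.induction_on with
  | C a =>
    simp [Polynomial.algebraMap_apply]
  | add p q hp hq => simp only [map_add, Polynomial.coeff_add, hp, hq]
  | mul_X p j hp =>
    simp only [map_mul, Polynomial.mul_coeff_zero, hp, aeval_X, eval_X]
    simp

lemma dvd_lineExp {R : Type*} [CommRing R] [IsDomain R] [CharZero R] [Algebra ℂ R] (m : ℕ) :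
    ∀ (v : Fin 4 → ℂ) (u : Fin 4 → R) (F : MvPolynomial (Fin 4) ℂ), vanishesToOrder F v m →
    (Polynomial.X : Polynomial R) ^ m ∣ lineExp v u F := by
  induction m with
  | zero => intros; simp
  | succ m ih =>
    intro v u F h
    have hd : (Polynomial.X : Polynomial R) ^ m ∣ Polynomial.derivative (lineExp v u F) := by
      rw [derivative_lineExp]
      apply Finset.dvd_sum
      intro i _
      apply Dvd.dvd.mul_left
      apply ih
      intro l hl
      exact h (i :: l) (by simpa using hl)
    rw [Polynomial.X_pow_dvd_iff] at hd ⊢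
    intro k hk
    cases k with
    | zero =>
      rw [lineExp_coeff_zero]
      have := h [] (by simp)
      simp only [List.foldl_nil] at this
      rw [this, map_zero]
    | succ k =>
      have := hd k (by omega)
      rw [Polynomial.coeff_derivative] at this
      rcases mul_eq_zero.1 this with h | h
      · exact h
      · exfalso
        exact Nat.cast_add_one_ne_zero k h

lemma hom_smul {A : Type*} [CommRing A] [Algebra ℂ A] {F : MvPolynomial (Fin 4) ℂ} {d : ℕ}
    (hF : F.IsHomogeneous d) (c : ℂ) (x : Fin 4 → A) :
    aeval (fun i => c • x i) F = c ^ d • aeval x F := by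
  rw [aeval_def, aeval_def, eval₂_eq', eval₂_eq', Finset.smul_sum]
  apply Finset.sum_congr rfl
  intro s hs
  have := hF.degree_eq_sum_deg_support hs
  simp only [smul_pow, Finset.prod_smul, Finset.prod_pow_eq_pow_sum]
  rw [mul_smul_comm]
  congr 2
  rw [this]
  exact (Finset.sum_subset (Finset.subset_univ _) (by simp)).symm

section affine

variable {σ : Type*} [Fintype σ] [DecidableEq σ]

/-- Substituting the constant `e` for the variable `i`. -/
noncomputable abbrev subst (i : σ) (e : ℂ) : MvPolynomial σ ℂ →ₐ[ℂ] MvPolynomial σ ℂ :=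
  aeval (Function.update X i (C e))

lemma subst_eq (i : σ) (e : ℂ) (f : MvPolynomial σ ℂ) :
    subst i e f = ∑ s ∈ f.support, monomial (s.erase i) (coeff s f * e ^ (s i)) := by
  rw [subst, aeval_def, eval₂_eq']
  apply Finset.sum_congr rfl
  intro s _
  rw [← Finset.mul_prod_erase _ _ (Finset.mem_univ i), monomial_eq,
    Finsupp.prod_fintype _ _ (by simp), ← Finset.mul_prod_erase _ _ (Finset.mem_univ i)]
  simp only [Function.update_self, Finsupp.erase_same, pow_zero, one_mul, map_mul, map_pow,
    MvPolynomial.algebraMap_eq]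
  rw [mul_assoc]
  congr 2
  apply Finset.prod_congr rfl
  intro j hj
  have hj : j ≠ i := Finset.ne_of_mem_erase hj
  rw [Function.update_of_ne hj, Finsupp.erase_ne hj]

lemma totalDegree_subst (i : σ) (e : ℂ) (f : MvPolynomial σ ℂ) :
    (subst i e f).totalDegree ≤ f.totalDegree := by
  rw [subst_eq]
  apply totalDegree_finsetSum_le
  intro s hs
  refine (totalDegree_monomial_le _ _).trans (le_trans ?_ (le_totalDegree hs))
  rw [Finsupp.sum_fintype _ _ (by simp), Finsupp.sum_fintype _ _ (by simp)]
  apply Finset.sum_le_sum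
  intro j _
  rw [Finsupp.erase_apply]
  split_ifs <;> simp

lemma degreeOf_subst (i j : σ) (e : ℂ) (f : MvPolynomial σ ℂ)
    (h : j ≠ i → f.degreeOf j = 0) :
    (subst i e f).degreeOf j = 0 := by
  rw [subst_eq, ← Nat.le_zero]
  refine (degreeOf_sum_le _ _ _).trans ?_
  apply Finset.sup_le
  intro s hs
  by_cases h0 : coeff s f * e ^ s i = 0
  · simp [h0]
  rw [degreeOf_monomial_eq _ _ h0, Finsupp.erase_apply]
  split_ifs with hj
  · simp
  · rw [← h hj]
    exact monomial_le_degreeOf j hs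

lemma dvd_of_subst (i : σ) (e : ℂ) (f : MvPolynomial σ ℂ) (h : subst i e f = 0) :
    (X i - C e) ∣ f := by
  rw [← Ideal.mem_span_singleton, ← Ideal.Quotient.eq_zero_iff_mem]
  have : (Ideal.Quotient.mkₐ ℂ (Ideal.span {(X i - C e : MvPolynomial σ ℂ)})).comp (subst i e) =
      Ideal.Quotient.mkₐ ℂ (Ideal.span {(X i - C e : MvPolynomial σ ℂ)}) := by
    apply MvPolynomial.algHom_ext
    intro j
    simp only [AlgHom.comp_apply, aeval_X]
    by_cases hj : j = i
    · subst hj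
      rw [Function.update_self]
      simp only [Ideal.Quotient.mkₐ_eq_mk]
      symm
      rw [Ideal.Quotient.eq]
      exact Ideal.mem_span_singleton_self _
    · rw [Function.update_of_ne hj]
  have h2 := DFunLike.congr_fun this f
  rw [AlgHom.comp_apply, h, map_zero] at h2
  exact h2.symm

/-- Generic expansion at `v`. -/
noncomputable abbrev expand (v : σ → ℂ) :
    MvPolynomial σ ℂ →ₐ[ℂ] Polynomial (MvPolynomial σ ℂ) :=
  lineExp v (fun i => X i)

lemma expand_subst (v : σ → ℂ) (i : σ) (f : MvPolynomial σ ℂ) (m : ℕ)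
    (h : Polynomial.X ^ m ∣ expand v f) : Polynomial.X ^ m ∣ expand v (subst i (v i) f) := by
  -- apply the map `X i ↦ 0` to the coefficients
  have key : expand v (subst i (v i) f) = Polynomial.mapAlgHom (subst i 0) (expand v f) := by
    have : (expand v).comp (subst i (v i)) =
        (Polynomial.mapAlgHom (subst i 0)).comp (expand v) := by
      apply MvPolynomial.algHom_ext
      intro j
      simp only [AlgHom.comp_apply, aeval_X]
      by_cases hj : j = i
      · subst hj
        simp [Polynomial.algebraMap_apply, MvPolynomial.algebraMap_eq]
      · simp [Function.update_of_ne hj, MvPolynomial.algebraMap_eq]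
    exact DFunLike.congr_fun this f
  rw [key]
  simpa using map_dvd (Polynomial.mapAlgHom (subst i (0 : ℂ))) h

lemma totalDegree_X_sub_C (i : σ) (e : ℂ) : (X i - C e : MvPolynomial σ ℂ).totalDegree = 1 := by
  rw [sub_eq_add_neg, totalDegree_add_eq_left_of_totalDegree_lt] <;> simp

lemma X_sub_C_ne (i : σ) (e : ℂ) : (X i - C e : MvPolynomial σ ℂ) ≠ 0 := by
  intro h
  have := totalDegree_X_sub_C i e
  rw [h] at this
  simp at this

lemma expand_div (v : σ → ℂ) (i : σ) (e : ℂ) (he : e ≠ 0) (hv : v i = e)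
    (q : MvPolynomial σ ℂ) (m : ℕ)
    (h : Polynomial.X ^ (m + 1) ∣ expand v ((X i - C e) * (X i - C (-e)) * q)) :
    Polynomial.X ^ m ∣ expand v q := by
  have e1 : expand v ((X i - C e) * (X i - C (-e)) * q) = Polynomial.X *
      ((Polynomial.C (X i) * (Polynomial.C (C (2 * e)) + Polynomial.X * Polynomial.C (X i)))
        * expand v q) := by
    simp only [map_mul, map_sub, aeval_X, hv, map_neg, algHom_C, Polynomial.algebraMap_apply,
      MvPolynomial.algebraMap_eq]
    have : (C 2 : MvPolynomial σ ℂ) = 2 := rfl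
    rw [this]
    have : (Polynomial.C 2 : Polynomial (MvPolynomial σ ℂ)) = 2 := rfl
    rw [this]
    ring
  rw [e1, pow_succ', mul_dvd_mul_iff_left Polynomial.X_ne_zero] at h
  refine Polynomial.prime_X.pow_dvd_of_dvd_mul_left _ ?_ h
  rw [Polynomial.X_dvd_iff]
  simp [he]

lemma expand_update (v : σ → ℂ) (i : σ) (e : ℂ) (f : MvPolynomial σ ℂ) :
    expand (Function.update v i e) (subst i e f) = expand v (subst i e f) := by
  have : (expand (Function.update v i e)).comp (subst i e) =
      (expand v).comp (subst i e) := by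
    apply MvPolynomial.algHom_ext
    intro k
    simp only [AlgHom.comp_apply, aeval_X]
    by_cases hk : k = i
    · subst hk
      rw [Function.update_self, algHom_C, algHom_C]
    · rw [Function.update_of_ne hk, aeval_X, aeval_X, Function.update_of_ne hk]
  exact DFunLike.congr_fun this f

theorem affine_main (S : Finset σ) : ∀ (m : ℕ) (f : MvPolynomial σ ℂ),
    (∀ j, j ∉ S → f.degreeOf j = 0) → f.totalDegree < 2 * m →
    (∀ v : σ → ℂ, (∀ i, v i = 1 ∨ v i = -1) → Polynomial.X ^ m ∣ expand v f) → f = 0 := by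
  induction S using Finset.induction_on with
  | empty =>
    intro m f hj hd hv
    have hc : f.totalDegree = 0 := by
      rw [totalDegree_eq_zero_iff]
      intro s hs j
      have := monomial_le_degreeOf j hs
      rw [hj j (by simp)] at this
      omega
    rw [totalDegree_eq_zero_iff_eq_C] at hc
    have h1 := (dvd_pow_self Polynomial.X (by omega : m ≠ 0)).trans (hv (fun _ => 1) (by simp))
    rw [hc, algHom_C, Polynomial.X_dvd_iff] at h1
    rw [hc]
    simpa [Polynomial.algebraMap_apply, MvPolynomial.algebraMap_eq] using h1
  | insert i S hi IH =>
    intro m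
    induction m with
    | zero => intro f _ hd; omega
    | succ m ihm =>
      intro f hj hd hv
      have hdiv : ∀ e : ℂ, (e = 1 ∨ e = -1) → (X i - C e) ∣ f := by
        intro e he
        apply dvd_of_subst
        apply IH (m + 1)
        · intro j hjS
          apply degreeOf_subst
          intro hji
          exact hj j (by simp [hji, hjS])
        · exact (totalDegree_subst i e f).trans_lt hd
        · intro v hv1
          have h1 := expand_subst (Function.update v i e) i f (m + 1) (hv _ (by
            intro k
            by_cases hk : k = i
            · subst hk; simpa using he
            · simpa [Function.update_of_ne hk] using hv1 k))
          rw [Function.update_self] at h1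
          have h3 : expand (Function.update v i e) (subst i e f) = expand v (subst i e f) := by
            exact expand_update v i e f
          rwa [h3] at h1
      have hcop : IsCoprime (X i - C 1 : MvPolynomial σ ℂ) (X i - C (-1)) := by
        refine ⟨-C (1/2), C (1/2), ?_⟩
        have : (C (1/2) * C 2 : MvPolynomial σ ℂ) = 1 := by
          rw [← C_mul]; norm_num
        have h2 : (C 2 : MvPolynomial σ ℂ) = 2 := rfl
        rw [h2] at this
        simp only [map_neg, C_1]
        linear_combination this
      obtain ⟨q, hq⟩ := hcop.mul_dvd (hdiv 1 (by simp)) (hdiv (-1) (by simp))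
      by_contra hf
      have hq0 : q ≠ 0 := by rintro rfl; simp at hq; exact hf hq
      have hl0 : ((X i - C 1) * (X i - C (-1)) : MvPolynomial σ ℂ) ≠ 0 :=
        mul_ne_zero (X_sub_C_ne _ _) (X_sub_C_ne _ _)
      apply hq0
      apply ihm
      · intro j hjS
        have := hj j hjS
        rw [hq, degreeOf_mul_eq hl0 hq0] at this
        omega
      · rw [hq, totalDegree_mul_of_isDomain hl0 hq0,
          totalDegree_mul_of_isDomain (X_sub_C_ne _ _) (X_sub_C_ne _ _),
          totalDegree_X_sub_C, totalDegree_X_sub_C] at hd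
        omega
      · intro v hv1
        have h := hv v hv1
        rcases hv1 i with h1 | h1
        · rw [hq] at h
          exact expand_div v i 1 one_ne_zero h1 q m h
        · rw [hq, mul_comm (X i - C 1 : MvPolynomial σ ℂ)] at h
          exact expand_div v i (-1) (by simp) h1 q m (by simpa using h)

end affine

/-- Linear change of coordinates. -/
noncomputable def lin : Fin 4 → MvPolynomial (Fin 4) ℂ :=
  ![X 0 + X 1, X 0 - X 1, X 2 + X 3, X 2 - X 3]

lemma lin_inj (F : MvPolynomial (Fin 4) ℂ) (h : aeval lin F = 0) : F = 0 := by
  have h1 : (aeval (fun i => C (1/2) * lin i) : MvPolynomial (Fin 4) ℂ →ₐ[ℂ] _).comp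
      (aeval lin) = AlgHom.id ℂ (MvPolynomial (Fin 4) ℂ) := by
    apply MvPolynomial.algHom_ext
    have : (C (1/2) * C 2 : MvPolynomial (Fin 4) ℂ) = 1 := by
      rw [← C_mul]; norm_num
    have h2 : (C 2 : MvPolynomial (Fin 4) ℂ) = 2 := rfl
    rw [h2] at this
    intro i
    fin_cases i <;> simp [lin, -one_div, -map_inv₀]
    · linear_combination (X 0) * this
    · linear_combination (X 1) * this
    · linear_combination (X 2) * this
    · linear_combination (X 3) * this
  have := DFunLike.congr_fun h1 F
  rw [AlgHom.comp_apply, h, map_zero] at this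
  exact this.symm

/-- The points in the new coordinates. -/
noncomputable def pt (v : Fin 4 → ℂ) : Fin 4 → ℂ :=
  ![(v 0 + v 1) / (2 * v 0), (v 0 - v 1) / (2 * v 0), (v 2 + v 3) / (2 * v 0),
    (v 2 - v 3) / (2 * v 0)]

lemma pt_mem (v : Fin 4 → ℂ) (hv : ∀ i, v i = 1 ∨ v i = -1) : pt v ∈ D4Config := by
  have hv0 : v 0 ≠ 0 := by rcases hv 0 with h | h <;> simp [h]
  have p0 : pt v 0 = (v 0 + v 1) / (2 * v 0) := rfl
  have p1 : pt v 1 = (v 0 - v 1) / (2 * v 0) := rfl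
  have p2 : pt v 2 = (v 2 + v 3) / (2 * v 0) := rfl
  have p3 : pt v 3 = (v 2 - v 3) / (2 * v 0) := rfl
  have pm : ∀ i j, v i = v j ∨ v i = - v j := by
    intro i j
    rcases hv i with h | h <;> rcases hv j with hb | hb <;> simp [h, hb]
  have A : (pt v 0 = 1 ∧ pt v 1 = 0) ∨ (pt v 1 = 1 ∧ pt v 0 = 0) := by
    rcases pm 1 0 with h | h
    · left; rw [p0, p1, h]; constructor <;> field_simp <;> ring
    · right; rw [p0, p1, h]; constructor <;> field_simp <;> ring
  have B : ((pt v 2 = 1 ∨ pt v 2 = -1) ∧ pt v 3 = 0) ∨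
      ((pt v 3 = 1 ∨ pt v 3 = -1) ∧ pt v 2 = 0) := by
    rcases pm 3 2 with h | h
    · left
      rcases pm 2 0 with hb | hb <;> rw [p2, p3, h, hb]
      · exact ⟨Or.inl (by field_simp; ring), by simp⟩
      · exact ⟨Or.inr (by field_simp; ring), by simp⟩
    · right
      rcases pm 2 0 with hb | hb <;> rw [p2, p3, h, hb]
      · exact ⟨Or.inl (by field_simp; ring), by simp⟩
      · exact ⟨Or.inr (by field_simp; ring), by simp⟩
  have C4 : ∀ k : Fin 4, k = 0 ∨ k = 1 ∨ k = 2 ∨ k = 3 := by decide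
  rcases A with ⟨a1, a2⟩ | ⟨a1, a2⟩ <;> rcases B with ⟨b1, b2⟩ | ⟨b1, b2⟩
  · refine ⟨0, 2, by decide, a1, b1, fun k => ?_⟩
    rcases C4 k with rfl | rfl | rfl | rfl <;> simp [a2, b2]
  · refine ⟨0, 3, by decide, a1, b1, fun k => ?_⟩
    rcases C4 k with rfl | rfl | rfl | rfl <;> simp [a2, b2]
  · refine ⟨1, 2, by decide, a1, b1, fun k => ?_⟩
    rcases C4 k with rfl | rfl | rfl | rfl <;> simp [a2, b2]
  · refine ⟨1, 3, by decide, a1, b1, fun k => ?_⟩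
    rcases C4 k with rfl | rfl | rfl | rfl <;> simp [a2, b2]

theorem lower (F : MvPolynomial (Fin 4) ℂ) (d m : ℕ) (hF : F.IsHomogeneous d) (hdm : d < 2 * m)
    (h : ∀ v ∈ D4Config, vanishesToOrder F v m) : F = 0 := by
  apply lin_inj
  apply affine_main Finset.univ m
  · simp
  · have hl : ∀ i, (lin i).IsHomogeneous 1 := by
      intro i
      fin_cases i
      · exact (isHomogeneous_X _ _).add (isHomogeneous_X _ _)
      · exact (isHomogeneous_X _ _).sub (isHomogeneous_X _ _)
      · exact (isHomogeneous_X _ _).add (isHomogeneous_X _ _)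
      · exact (isHomogeneous_X _ _).sub (isHomogeneous_X _ _)
    have := (hF.aeval lin hl).totalDegree_le
    omega
  · intro v hv
    have hv0 : v 0 ≠ 0 := by rcases hv 0 with h | h <;> simp [h]
    have hc : 2 * v 0 ≠ 0 := by simp [hv0]
    have key : expand v (aeval lin F) = aeval (fun i => (2 * v 0) •
        (Polynomial.C (algebraMap ℂ (MvPolynomial (Fin 4) ℂ) (pt v i)) +
          Polynomial.X * Polynomial.C ((2 * v 0)⁻¹ • lin i))) F := by
      have : (expand v).comp (aeval lin) = aeval (fun i => (2 * v 0) •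
        (Polynomial.C (algebraMap ℂ (MvPolynomial (Fin 4) ℂ) (pt v i)) +
          Polynomial.X * Polynomial.C ((2 * v 0)⁻¹ • lin i))) := by
        apply MvPolynomial.algHom_ext
        intro i
        simp only [AlgHom.comp_apply, aeval_X]
        have e1 : (2 * v 0) • (Polynomial.C (algebraMap ℂ (MvPolynomial (Fin 4) ℂ) (pt v i)) +
          Polynomial.X * Polynomial.C ((2 * v 0)⁻¹ • lin i)) =
          Polynomial.C (algebraMap ℂ (MvPolynomial (Fin 4) ℂ) ((2 * v 0) * pt v i)) +
          Polynomial.X * Polynomial.C (lin i) := by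
          rw [smul_add, ← mul_smul_comm, Polynomial.smul_C, Polynomial.smul_C, smul_smul,
            mul_inv_cancel₀ hc, one_smul, map_mul, Algebra.smul_def]
        rw [e1]
        fin_cases i
        · have : 2 * v 0 * pt v 0 = v 0 + v 1 := by simp [pt]; field_simp
          simp only [Fin.zero_eta, this]
          simp [lin]; ring
        · have : 2 * v 0 * pt v 1 = v 0 - v 1 := by simp [pt]; field_simp
          simp only [Fin.mk_one, this]
          simp [lin]; ring
        · have : 2 * v 0 * pt v 2 = v 2 + v 3 := by simp [pt]; field_simp
          simp only [Fin.reduceFinMk, this]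
          simp [lin]; ring
        · have : 2 * v 0 * pt v 3 = v 2 - v 3 := by simp [pt]; field_simp
          simp only [Fin.reduceFinMk, this]
          simp [lin]; ring
      exact DFunLike.congr_fun this F
    rw [key, hom_smul hF]
    rw [Algebra.smul_def]
    exact Dvd.dvd.mul_left (dvd_lineExp m (pt v) _ F (h _ (pt_mem v hv))) _

lemma pderiv_mem_pow (I : Ideal (MvPolynomial (Fin 4) ℂ)) (i : Fin 4) (n : ℕ) :
    ∀ F ∈ I ^ (n + 1), pderiv i F ∈ I ^ n := by
  induction n with
  | zero => intro F _; simp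
  | succ n ih =>
    intro F hF
    rw [pow_succ] at hF
    refine Submodule.mul_induction_on hF ?_ ?_
    · intro a ha b hb
      rw [Derivation.leibniz, smul_eq_mul, smul_eq_mul]
      refine Ideal.add_mem _ (Ideal.mul_mem_right _ _ ha) ?_
      rw [pow_succ, mul_comm b]
      exact Ideal.mul_mem_mul (ih a ha) hb
    · intro a b ha hb
      rw [map_add]
      exact Ideal.add_mem _ ha hb

lemma vanishes_of_mem (v : Fin 4 → ℂ) (m : ℕ) : ∀ F ∈ RingHom.ker (eval v) ^ m,
    vanishesToOrder F v m := by
  induction m with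
  | zero => intro F _ l hl; simp at hl
  | succ m ih =>
    intro F hF l hl
    cases l with
    | nil =>
      have := Ideal.pow_le_self (Nat.succ_ne_zero m) hF
      simpa [RingHom.mem_ker] using this
    | cons i l =>
      exact ih _ (pderiv_mem_pow _ i m F hF) l (by simpa using hl)

/-- The product of the coordinates. -/
noncomputable def P : MvPolynomial (Fin 4) ℂ := X 0 * X 1 * X 2 * X 3

lemma P_hom : P.IsHomogeneous 4 :=
  (((isHomogeneous_X _ _).mul (isHomogeneous_X _ _)).mul (isHomogeneous_X _ _)).mul
    (isHomogeneous_X _ _)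

lemma P_ne : P ≠ 0 := by simp [P, X_ne_zero]

lemma two_zeros (v : Fin 4 → ℂ) (hv : v ∈ B4Config) : ∃ i j : Fin 4, i < j ∧ v i = 0 ∧ v j = 0 := by
  have comp : ∀ i j : Fin 4, ∃ a b : Fin 4, a < b ∧ a ≠ i ∧ a ≠ j ∧ b ≠ i ∧ b ≠ j := by decide
  rcases hv with ⟨i, j, _, _, _, h⟩ | ⟨i, rfl⟩
  · obtain ⟨a, b, hab, h1, h2, h3, h4⟩ := comp i j
    exact ⟨a, b, hab, h a h1 h2, h b h3 h4⟩
  · obtain ⟨a, b, hab, h1, h2, h3, h4⟩ := comp i i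
    exact ⟨a, b, hab, by simp [h1], by simp [h3]⟩

lemma P_mem (v : Fin 4 → ℂ) (hv : v ∈ B4Config) : P ∈ RingHom.ker (eval v) ^ 2 := by
  obtain ⟨i, j, hij, hi, hj⟩ := two_zeros v hv
  have hm : (X i * X j : MvPolynomial (Fin 4) ℂ) ∈ RingHom.ker (eval v) ^ 2 := by
    rw [pow_two]
    apply Ideal.mul_mem_mul <;> simp [RingHom.mem_ker, hi, hj]
  have hd : (X i * X j : MvPolynomial (Fin 4) ℂ) ∣ P := by
    have e : P = ∏ k : Fin 4, X k := by simp [P, Fin.prod_univ_four]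
    rw [e, ← Finset.prod_pair hij.ne]
    exact Finset.prod_dvd_prod_of_subset _ _ _ (Finset.subset_univ _)
  exact Ideal.mem_of_dvd _ hd hm

lemma alpha_ge (m : ℕ) : 2 * m ≤ alphaSymbolic B4Config m := by
  have hne : { d | ∃ F : MvPolynomial (Fin 4) ℂ, F ≠ 0 ∧ F.IsHomogeneous d ∧
      ∀ v ∈ B4Config, vanishesToOrder F v m }.Nonempty := by
    refine ⟨4 * m, P ^ m, pow_ne_zero _ P_ne, P_hom.pow m, ?_⟩
    intro v hv
    apply vanishes_of_mem
    exact Ideal.pow_mem_pow (Ideal.pow_le_self two_ne_zero (P_mem v hv)) m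
  obtain ⟨F, h0, hF, h⟩ := Nat.sInf_mem hne
  by_contra hlt
  exact h0 (lower F _ m hF (not_le.1 hlt) (fun v hv => h v (Or.inl hv)))

lemma alpha_two : alphaSymbolic B4Config 2 ≤ 4 :=
  Nat.sInf_le ⟨P, P_ne, P_hom, fun v hv => vanishes_of_mem v 2 P (P_mem v hv)⟩

end B4Proof

/-- The Waldschmidt constant of the B4 configuration equals 2. -/
theorem waldschmidt_B4 :
    sInf { x : ℝ | ∃ m : ℕ, 1 ≤ m ∧ x = (alphaSymbolic B4Config m : ℝ) / m } = 2 := by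
  apply IsLeast.csInf_eq
  constructor
  · refine ⟨2, by norm_num, ?_⟩
    have : alphaSymbolic B4Config 2 = 4 := le_antisymm B4Proof.alpha_two (B4Proof.alpha_ge 2)
    rw [this]; norm_num
  · rintro x ⟨m, hm, rfl⟩
    have hmpos : (0 : ℝ) < m := by exact_mod_cast hm
    rw [le_div_iff₀ hmpos]
    exact_mod_cast B4Proof.alpha_ge m
end
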